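/- Let K be a number field and let B be a central division algebra over K with dim_K B = (2m)², where m is an odd positive integer. Then there exist a central division K-algebra B₁ with dim_K B₁ = 4 and a central division K-algebra B₂ with dim_K B₂ = m² such that B is isomorphic as a K-algebra to B₁ ⊗_K B₂. -/

import Mathlib

open scoped TensorProduct

namespace CentralSimple

variable {K : Type*} [Field K]

section Multiplication

variable (A : Type*) [Ring A] [Algebra K A] [Algebra.IsCentral K A] [IsSimpleRing A]
  [FiniteDimensional K A]

theorem mulLeftRight_surjective : Function.Surjective (AlgHom.mulLeftRight K A) := by
  classical
  let : Module (A ⊗[K] Aᵐᵒᵖ) A := TensorProduct.Algebra.module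
  have smul_eq (a : A) (b : Aᵐᵒᵖ) (x : A) : (a ⊗ₜ[K] b) • x = a * x * b.unop := by
    rw [← AlgHom.mulLeftRight_apply (R := K)]; rfl
  have : IsSimpleModule (A ⊗[K] Aᵐᵒᵖ) A := by
    rw [isSimpleModule_iff]
    refine { exists_pair_ne := ⟨⊥, ⊤, bot_ne_top⟩, eq_bot_or_eq_top := fun N ↦ ?_ }
    rw [or_iff_not_imp_left]
    intro hN
    obtain ⟨x, hxN, hx⟩ := N.exists_mem_ne_zero_of_ne_bot hN
    let I : TwoSidedIdeal A := .mk' N N.zero_mem N.add_mem N.neg_mem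
      (fun {a x} hx ↦ by simpa [smul_eq] using N.smul_mem (a ⊗ₜ[K] 1) hx)
      (fun {x a} hx ↦ by simpa [smul_eq] using N.smul_mem (1 ⊗ₜ[K] (.op a)) hx)
    have h1 : (1 : A) ∈ I :=
      IsSimpleRing.one_mem_of_ne_zero_mem I hx ((TwoSidedIdeal.mem_mk' ..).2 hxN)
    rw [TwoSidedIdeal.mem_mk'] at h1
    refine eq_top_iff.2 fun y _ ↦ ?_
    simpa [smul_eq] using N.smul_mem (y ⊗ₜ[K] 1) h1
  intro T
  have hcomm (φ : Module.End (A ⊗[K] Aᵐᵒᵖ) A) : ∃ c : K, ∀ x, φ x = c • x := by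
    have hl (a x : A) : φ (a * x) = a * φ x := by
      simpa [smul_eq] using φ.map_smul (a ⊗ₜ[K] 1) x
    have hr (a x : A) : φ (x * a) = φ x * a := by
      simpa [smul_eq] using φ.map_smul (1 ⊗ₜ[K] (.op a)) x
    have hc : φ 1 ∈ Subalgebra.center K A := by
      rw [Subalgebra.mem_center_iff]
      intro b
      rw [← hl, ← hr, mul_one, one_mul]
    obtain ⟨c, hc⟩ := (Algebra.IsCentral.mem_center_iff K).1 hc
    refine ⟨c, fun x ↦ ?_⟩
    have := hr x 1
    rwa [one_mul, hc, ← Algebra.smul_def] at this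
  let f : Module.End (Module.End (A ⊗[K] Aᵐᵒᵖ) A) A :=
    { toFun := T
      map_add' := T.map_add
      map_smul' := fun φ x ↦ by
        obtain ⟨c, hc⟩ := hcomm φ
        simp [hc] }
  let b := Module.finBasis K A
  obtain ⟨r, hr⟩ := jacobson_density (R := A ⊗[K] Aᵐᵒᵖ) f (Finset.univ.image b)
  refine ⟨r, b.ext fun i ↦ ?_⟩
  exact (hr (b i) (by simp)).symm

theorem rTensor_mulLeftRight_tmul {A B : Type*} [Ring A] [Algebra K A] [Ring B] [Algebra K B]
    (a : A) (c : Aᵐᵒᵖ) (x : A ⊗[K] B) :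
    (AlgHom.mulLeftRight K A (a ⊗ₜ c)).rTensor B x = (a ⊗ₜ 1) * x * (c.unop ⊗ₜ 1) := by
  induction x with
  | zero => simp
  | add s t hs ht => rw [map_add, hs, ht, mul_add, add_mul]
  | tmul y z => simp

theorem rTensor_smulRight {A B : Type*} [Ring A] [Algebra K A] [Ring B] [Algebra K B]
    (f : A →ₗ[K] K) (a : A) (x : A ⊗[K] B) :
    (f.smulRight a).rTensor B x = a ⊗ₜ TensorProduct.lid K B (f.rTensor B x) := by
  induction x with
  | zero => simp
  | add s t hs ht => rw [map_add, hs, ht, map_add, map_add, TensorProduct.tmul_add]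
  | tmul y z => simp [TensorProduct.smul_tmul]

variable (B : Type*) [Ring B] [Algebra K B]

instance isSimpleRing_tensorProduct [IsSimpleRing B] : IsSimpleRing (A ⊗[K] B) := by
  classical
  let b := Module.finBasis K A
  refine .of_eq_bot_or_eq_top fun I ↦ ?_
  rw [or_iff_not_imp_left]
  intro hI
  have hI' : ∃ x ∈ I, x ≠ 0 := by
    by_contra! h
    exact hI (eq_bot_iff.2 fun x hx ↦ by simpa using h x hx)
  obtain ⟨x, hxI, hx⟩ := hI'
  have key (T : Module.End K A) : T.rTensor B x ∈ I := by
    obtain ⟨t, rfl⟩ := mulLeftRight_surjective A T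
    induction t with
    | zero => simp [I.zero_mem]
    | add s t hs ht => simpa [LinearMap.rTensor_add] using I.add_mem hs ht
    | tmul a c =>
      rw [rTensor_mulLeftRight_tmul]
      exact I.mul_mem_right _ _ (I.mul_mem_left _ _ hxI)
  obtain ⟨i, hi⟩ : ∃ i, TensorProduct.lid K B ((b.coord i).rTensor B x) ≠ 0 := by
    by_contra! h
    have hid : (LinearMap.id : A →ₗ[K] A) = ∑ i, (b.coord i).smulRight (b i) := by
      ext y
      simp
    apply hx
    calc x = (LinearMap.id : A →ₗ[K] A).rTensor B x := by simp
      _ = ∑ i, ((b.coord i).smulRight (b i)).rTensor B x := by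
        rw [hid, ← LinearMap.coe_rTensorHom, map_sum, LinearMap.sum_apply]
      _ = 0 := Finset.sum_eq_zero fun i _ ↦ by rw [rTensor_smulRight, h, TensorProduct.tmul_zero]
  have hmem := key ((b.coord i).smulRight 1)
  rw [rTensor_smulRight] at hmem
  have h1 := IsSimpleRing.one_mem_of_ne_zero_mem
    (I.comap (Algebra.TensorProduct.includeRight : B →ₐ[K] A ⊗[K] B)) hi
    ((TwoSidedIdeal.mem_comap _).2 hmem)
  rw [TwoSidedIdeal.mem_comap, map_one] at h1
  exact I.one_mem_iff.1 h1

instance isCentral_tensorProduct [Algebra.IsCentral K B] : Algebra.IsCentral K (A ⊗[K] B) where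
  out z hz := by
    have key (T : Module.End K A) : T.rTensor B z = z * (T 1 ⊗ₜ 1) := by
      obtain ⟨t, rfl⟩ := mulLeftRight_surjective A T
      induction t with
      | zero => simp
      | add s t hs ht => simp [LinearMap.rTensor_add, hs, ht, TensorProduct.add_tmul, mul_add]
      | tmul a c =>
        rw [rTensor_mulLeftRight_tmul, Subalgebra.mem_center_iff.1 hz, mul_assoc]
        simp
    obtain ⟨f, hf⟩ : ∃ f : A →ₗ[K] K, f 1 = 1 :=
      Module.Projective.exists_dual_eq_one K one_ne_zero
    have hz1 := key (f.smulRight 1)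
    rw [rTensor_smulRight, LinearMap.smulRight_apply, hf, one_smul,
      ← Algebra.TensorProduct.one_def, mul_one] at hz1
    set c := TensorProduct.lid K B (f.rTensor B z)
    have hc : c ∈ Subalgebra.center K B := by
      rw [Subalgebra.mem_center_iff]
      intro d
      apply Algebra.TensorProduct.includeRight_injective (R := K) (A := A) (B := B)
        (FaithfulSMul.algebraMap_injective K A)
      have := Subalgebra.mem_center_iff.1 hz (1 ⊗ₜ d)
      rw [← hz1] at this
      simpa using this
    obtain ⟨k, hk⟩ := (Algebra.IsCentral.mem_center_iff K).1 hc
    rw [Algebra.mem_bot]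
    exact ⟨k, by rw [← hz1, hk, Algebra.TensorProduct.algebraMap_apply,
      Algebra.TensorProduct.tmul_one_eq_one_tmul]⟩

end Multiplication

section Wedderburn

open scoped Matrix.Module

variable (K : Type*) [Field K] (D : Type*) [DivisionRing D] [Algebra K D] (n : ℕ) [NeZero n]

instance isSimpleModule_column : IsSimpleModule (Matrix (Fin n) (Fin n) D) (Fin n → D) := by
  rw [isSimpleModule_iff_toSpanSingleton_surjective]
  refine ⟨inferInstance, fun v hv w ↦ ?_⟩
  obtain ⟨j, hj⟩ := Function.ne_iff.1 hv
  refine ⟨.of fun i k ↦ if k = j then w i * (v j)⁻¹ else 0, ?_⟩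
  ext i
  have hj : v j ≠ 0 := hj
  simp [mul_assoc, hj]

/-- Scaling columns on the right identifies `Dᵐᵒᵖ` with the endomorphisms of the column module. -/
noncomputable def columnEndHom :
    Dᵐᵒᵖ →ₐ[K] Module.End (Matrix (Fin n) (Fin n) D) (Fin n → D) :=
  AlgHom.ofLinearMap
    { toFun := fun d ↦
        { toFun := fun v ↦ d • v
          map_add' := smul_add d
          map_smul' := fun r v ↦ by
            ext i
            simp [Finset.sum_mul, mul_assoc] }
      map_add' := fun d d' ↦ by ext; simp [mul_add]
      map_smul' := fun k d ↦ by ext; simp }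
    (by ext; simp) (fun d d' ↦ by ext; simp [mul_assoc])

theorem columnEndHom_bijective : Function.Bijective (columnEndHom K D n) := by
  refine ⟨(columnEndHom K D n).toRingHom.injective, fun g ↦ ?_⟩
  let e : Fin n → D := Pi.single 0 1
  refine ⟨.op (g e 0), LinearMap.ext fun v ↦ ?_⟩
  have hv : v = (Matrix.of fun i k ↦ if k = 0 then v i else 0 : Matrix (Fin n) (Fin n) D) • e := by
    ext i
    simp [e, Pi.single_apply]
  have hg : g v =
      (Matrix.of fun i k ↦ if k = 0 then v i else 0 : Matrix (Fin n) (Fin n) D) • g e := by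
    rw [← map_smul, ← hv]
  rw [hg]
  ext i
  simp [columnEndHom]

/-- Restriction of scalars along an algebra isomorphism does not change endomorphisms. -/
def endCongr {R R' V : Type*} [Ring R] [Algebra K R] [Ring R'] [Algebra K R'] [AddCommGroup V]
    [Module K V] [Module R V] [IsScalarTower K R V] [Module R' V] [IsScalarTower K R' V]
    (φ : R ≃ₐ[K] R') (h : ∀ r (v : V), φ r • v = r • v) :
    Module.End R' V ≃ₐ[K] Module.End R V where
  toFun f := { f with map_smul' := fun r v ↦ by simp [← h] }
  invFun f := { f with map_smul' := fun r v ↦ (by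
    rw [← φ.apply_symm_apply r, h]
    exact (f.map_smul (φ.symm r) v).trans (h _ _).symm : f (r • v) = r • f v) }
  left_inv _ := rfl
  right_inv _ := rfl
  map_mul' _ _ := rfl
  map_add' _ _ := rfl
  commutes' _ := rfl

variable {K D n} {R : Type*} [Ring R] [Algebra K R]

theorem nonempty_linearEquiv_of_isSimpleModule [IsSimpleRing R] [IsArtinianRing R]
    (S T : Type*) [AddCommGroup S] [Module R S] [IsSimpleModule R S]
    [AddCommGroup T] [Module R T] [IsSimpleModule R T] : Nonempty (S ≃ₗ[R] T) := by
  obtain ⟨I, ⟨e⟩⟩ := IsSemisimpleRing.exists_linearEquiv_ideal_of_isSimpleModule R S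
  obtain ⟨J, ⟨f⟩⟩ := IsSemisimpleRing.exists_linearEquiv_ideal_of_isSimpleModule R T
  have := IsSimpleModule.congr e.symm
  have := IsSimpleModule.congr f.symm
  obtain ⟨g⟩ := IsSimpleRing.isIsotypic R R J I
  exact ⟨(e.trans g).trans f.symm⟩

variable [FiniteDimensional K D]

theorem simpleModule_structure [IsSimpleRing R] [IsArtinianRing R]
    (φ : R ≃ₐ[K] Matrix (Fin n) (Fin n) D)
    (S : Type*) [AddCommGroup S] [Module K S] [Module R S] [IsScalarTower K R S]
    [IsSimpleModule R S] :
    Nonempty (Dᵐᵒᵖ ≃ₐ[K] Module.End R S) ∧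
      Module.finrank K S = n * Module.finrank K D := by
  let : Module R (Fin n → D) := Module.compHom _ φ.toRingEquiv.toRingHom
  have h (r : R) (v : Fin n → D) : φ r • v = r • v := rfl
  have : IsScalarTower K R (Fin n → D) := ⟨fun k r v ↦ by simp [← h]⟩
  have : IsSimpleModule R (Fin n → D) := by
    rw [isSimpleModule_iff_toSpanSingleton_surjective]
    refine ⟨inferInstance, fun v hv w ↦ ?_⟩
    obtain ⟨r, hr⟩ := IsSimpleModule.toSpanSingleton_surjective (Matrix (Fin n) (Fin n) D) hv w
    exact ⟨φ.symm r, by simpa [← h] using hr⟩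
  obtain ⟨e⟩ := nonempty_linearEquiv_of_isSimpleModule (R := R) (Fin n → D) S
  refine ⟨⟨((AlgEquiv.ofBijective _ (columnEndHom_bijective K D n)).trans (endCongr K φ h)).trans
    (e.conjAlgEquiv K)⟩, ?_⟩
  rw [← (e.restrictScalars K).finrank_eq]
  simp [Module.finrank_pi_fintype]

theorem mul_finrank_dvd_finrank [IsSimpleRing R] [IsArtinianRing R]
    (φ : R ≃ₐ[K] Matrix (Fin n) (Fin n) D)
    (M : Type*) [AddCommGroup M] [Module K M] [Module R M] [IsScalarTower K R M]
    [FiniteDimensional K M] : n * Module.finrank K D ∣ Module.finrank K M := by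
  rcases subsingleton_or_nontrivial M with hM | hM
  · simp [Module.finrank_zero_of_subsingleton]
  have : Module.Finite R M := Module.Finite.of_restrictScalars_finite K R M
  obtain ⟨k, -, S, hS, ⟨e⟩⟩ := (IsSimpleRing.isIsotypic R M).linearEquiv_fun
  have hk := (e.restrictScalars K).finrank_eq
  have : FiniteDimensional K S :=
    inferInstanceAs (FiniteDimensional K (S.restrictScalars K))
  rw [Module.finrank_pi_fintype] at hk
  rw [hk, ← (simpleModule_structure φ S).2]
  simp

theorem nonempty_algEquiv_of_matrix_algEquiv {E : Type*} [DivisionRing E] [Algebra K E]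
    [FiniteDimensional K E] {m : ℕ} [NeZero m]
    (φ : Matrix (Fin n) (Fin n) D ≃ₐ[K] Matrix (Fin m) (Fin m) E) : Nonempty (D ≃ₐ[K] E) := by
  have := IsArtinianRing.of_finite K (Matrix (Fin n) (Fin n) D)
  obtain ⟨e⟩ := (simpleModule_structure (.refl : _ ≃ₐ[K] Matrix (Fin n) (Fin n) D)
    (Fin n → D)).1
  obtain ⟨f⟩ := (simpleModule_structure φ (Fin n → D)).1
  exact ⟨AlgEquiv.unop (e.trans f.symm)⟩

theorem isCentral_of_matrix {K D : Type*} [Field K] [Ring D] [Algebra K D] (n : ℕ) [NeZero n]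
    [Algebra.IsCentral K (Matrix (Fin n) (Fin n) D)] : Algebra.IsCentral K D where
  out d hd := by
    have hd' : Matrix.scalar (Fin n) d ∈ Subalgebra.center K (Matrix (Fin n) (Fin n) D) := by
      rw [Subalgebra.mem_center_iff] at hd ⊢
      intro M
      ext i j
      simp [hd]
    obtain ⟨k, hk⟩ := (Algebra.IsCentral.mem_center_iff K).1 hd'
    refine Algebra.mem_bot.2 ⟨k, ?_⟩
    simpa [Matrix.algebraMap_matrix_apply] using (congr_fun₂ hk 0 0).symm

theorem exists_algEquiv_matrix.{u, v} (K : Type u) (A : Type v) [Field K] [Ring A]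
    [Algebra K A] [IsSimpleRing A] [Algebra.IsCentral K A] [FiniteDimensional K A] :
    ∃ (n : ℕ) (_ : NeZero n) (D : Type v) (_ : DivisionRing D) (_ : Algebra K D)
      (_ : FiniteDimensional K D) (_ : Algebra.IsCentral K D),
      Nonempty (A ≃ₐ[K] Matrix (Fin n) (Fin n) D) := by
  have := IsArtinianRing.of_finite K A
  obtain ⟨n, hn, D, _, _, _, ⟨e⟩⟩ := IsSimpleRing.exists_algEquiv_matrix_divisionRing_finite K A
  have := Algebra.IsCentral.of_algEquiv K _ _ e
  exact ⟨n, hn, D, _, _, ‹_›, isCentral_of_matrix n, ⟨e⟩⟩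

end Wedderburn

section Brauer

universe u

variable {K : Type u} [Field K]

section BrauerClass

variable (K) (A B : Type u) [Ring A] [Algebra K A] [Algebra.IsCentral K A] [IsSimpleRing A]
  [FiniteDimensional K A] [Ring B] [Algebra K B] [Algebra.IsCentral K B] [IsSimpleRing B]
  [FiniteDimensional K B]

/-- The class of a central simple algebra in the Brauer group. -/
def brauerClass : BrauerGroup.{u, u} K :=
  Quotient.mk (Brauer.CSA_Setoid K) { AlgCat.of K A with }

variable {K A B}

theorem brauerClass_eq_iff : brauerClass K A = brauerClass K B ↔ ∃ n m : ℕ, n ≠ 0 ∧ m ≠ 0 ∧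
    Nonempty (Matrix (Fin n) (Fin n) A ≃ₐ[K] Matrix (Fin m) (Fin m) B) :=
  Quotient.eq (r := Brauer.CSA_Setoid K)

theorem brauerClass_congr (e : A ≃ₐ[K] B) : brauerClass K A = brauerClass K B :=
  brauerClass_eq_iff.2 ⟨1, 1, one_ne_zero, one_ne_zero, ⟨e.mapMatrix⟩⟩

theorem brauerClass_eq_of_matrix {n : ℕ} [NeZero n] (e : A ≃ₐ[K] Matrix (Fin n) (Fin n) B) :
    brauerClass K A = brauerClass K B :=
  brauerClass_eq_iff.2 ⟨1, n, one_ne_zero, NeZero.ne n,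
    ⟨e.mapMatrix.trans <| (Matrix.compAlgEquiv _ _ _ _).trans <|
      Matrix.reindexAlgEquiv K B (Equiv.uniqueProd (Fin n) (Fin 1))⟩⟩

theorem brauerClass_induction {P : BrauerGroup.{u, u} K → Prop}
    (h : ∀ (A : Type u) [Ring A] [Algebra K A] [Algebra.IsCentral K A] [IsSimpleRing A]
      [FiniteDimensional K A], P (brauerClass K A)) (x : BrauerGroup.{u, u} K) : P x :=
  Quotient.inductionOn x fun A ↦ h A

end BrauerClass

noncomputable instance : Mul (BrauerGroup.{u, u} K) where
  mul := Quotient.map₂ (fun A B ↦ { AlgCat.of K (A ⊗[K] B) with }) (by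
    rintro A A' ⟨n, m, hn, hm, ⟨e⟩⟩ B B' ⟨p, q, hp, hq, ⟨f⟩⟩
    refine ⟨n * p, m * q, mul_ne_zero hn hp, mul_ne_zero hm hq, ⟨?_⟩⟩
    exact (Matrix.reindexAlgEquiv K _ finProdFinEquiv).symm.trans <|
      (Matrix.kroneckerTMulAlgEquiv (Fin n) (Fin p) K K A B).symm.trans <|
      (Algebra.TensorProduct.congr e f).trans <|
      (Matrix.kroneckerTMulAlgEquiv (Fin m) (Fin q) K K A' B').trans <|
      (Matrix.reindexAlgEquiv K _ finProdFinEquiv))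

theorem brauerClass_mul (A B : Type u) [Ring A] [Algebra K A] [Algebra.IsCentral K A]
    [IsSimpleRing A] [FiniteDimensional K A] [Ring B] [Algebra K B] [Algebra.IsCentral K B]
    [IsSimpleRing B] [FiniteDimensional K B] :
    brauerClass K A * brauerClass K B = brauerClass K (A ⊗[K] B) :=
  rfl

noncomputable instance : CommMonoid (BrauerGroup.{u, u} K) where
  mul_assoc x y z := by
    induction x using brauerClass_induction
    induction y using brauerClass_induction
    induction z using brauerClass_induction
    exact brauerClass_congr (Algebra.TensorProduct.assoc K K K _ _ _)
  one := brauerClass K K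
  one_mul x := by
    induction x using brauerClass_induction
    exact brauerClass_congr (Algebra.TensorProduct.lid K _)
  mul_one x := by
    induction x using brauerClass_induction
    exact brauerClass_congr (Algebra.TensorProduct.rid K K _)
  mul_comm x y := by
    induction x using brauerClass_induction
    induction y using brauerClass_induction
    exact brauerClass_congr (Algebra.TensorProduct.comm K _ _)

theorem brauerClass_self : brauerClass K K = 1 := rfl

end Brauer

section Splitting

variable (K A : Type*) [Field K] [Ring A] [Algebra K A] [Algebra.IsCentral K A] [IsSimpleRing A]
  [FiniteDimensional K A]

instance isSimpleRing_baseChange (F : Type*) [Field F] [Algebra K F] : IsSimpleRing (F ⊗[K] A) :=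
  .of_ringEquiv (Algebra.TensorProduct.comm K A F).toRingEquiv inferInstance

theorem exists_baseChange_algEquiv (F : Type*) [Field F] [Algebra K F] [IsAlgClosed F] :
    ∃ (n : ℕ) (_ : NeZero n), Nonempty (F ⊗[K] A ≃ₐ[F] Matrix (Fin n) (Fin n) F) ∧
      Module.finrank K A = n ^ 2 := by
  obtain ⟨n, hn, ⟨e⟩⟩ := IsSimpleRing.exists_algEquiv_matrix_of_isAlgClosed F (F ⊗[K] A)
  refine ⟨n, hn, ⟨e⟩, ?_⟩
  rw [← Module.finrank_baseChange (R := F), e.toLinearEquiv.finrank_eq]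
  simp [Module.finrank_matrix, sq]

end Splitting

section Index

universe u

variable {K : Type u} [Field K]

theorem nonempty_algEquiv_of_brauerClass_eq {D E : Type u} [DivisionRing D] [Algebra K D]
    [FiniteDimensional K D] [Algebra.IsCentral K D] [DivisionRing E] [Algebra K E]
    [FiniteDimensional K E] [Algebra.IsCentral K E] (h : brauerClass K D = brauerClass K E) :
    Nonempty (D ≃ₐ[K] E) := by
  obtain ⟨n, m, hn, hm, ⟨e⟩⟩ := brauerClass_eq_iff.1 h
  have : NeZero n := ⟨hn⟩
  have : NeZero m := ⟨hm⟩
  exact nonempty_algEquiv_of_matrix_algEquiv e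

theorem exists_index (x : BrauerGroup.{u, u} K) : ∃ (d : ℕ) (D : Type u) (_ : DivisionRing D)
    (_ : Algebra K D) (_ : FiniteDimensional K D) (_ : Algebra.IsCentral K D),
    brauerClass K D = x ∧ Module.finrank K D = d ^ 2 := by
  induction x using brauerClass_induction with | h A => ?_
  obtain ⟨n, hn, D, _, _, _, _, ⟨e⟩⟩ := exists_algEquiv_matrix K A
  obtain ⟨d, -, -, hd⟩ := exists_baseChange_algEquiv K D (AlgebraicClosure K)
  exact ⟨d, D, _, _, ‹_›, ‹_›, (brauerClass_eq_of_matrix e).symm, hd⟩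

/-- The Schur index of a Brauer class: the degree of the division algebra representing it. -/
noncomputable def index (x : BrauerGroup.{u, u} K) : ℕ := (exists_index x).choose

theorem exists_divisionRing (x : BrauerGroup.{u, u} K) : ∃ (D : Type u) (_ : DivisionRing D)
    (_ : Algebra K D) (_ : FiniteDimensional K D) (_ : Algebra.IsCentral K D),
    brauerClass K D = x ∧ Module.finrank K D = index x ^ 2 :=
  (exists_index x).choose_spec

theorem finrank_eq_index_sq (D : Type u) [DivisionRing D] [Algebra K D] [FiniteDimensional K D]
    [Algebra.IsCentral K D] : Module.finrank K D = index (brauerClass K D) ^ 2 := by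
  obtain ⟨E, _, _, _, _, hE, hfin⟩ := exists_divisionRing (brauerClass K D)
  obtain ⟨e⟩ := nonempty_algEquiv_of_brauerClass_eq hE
  rw [← hfin, e.toLinearEquiv.finrank_eq]

theorem index_pos (x : BrauerGroup.{u, u} K) : 0 < index x := by
  obtain ⟨D, _, _, _, _, -, h⟩ := exists_divisionRing x
  exact Nat.pos_of_ne_zero (by rintro h0; simp [h0] at h; exact Module.finrank_pos.ne' h)

theorem index_one : index (1 : BrauerGroup.{u, u} K) = 1 := by
  have := finrank_eq_index_sq (K := K) K
  rw [Module.finrank_self, brauerClass_self] at this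
  nlinarith

theorem eq_one_of_index_eq_one {x : BrauerGroup.{u, u} K} (hx : index x = 1) : x = 1 := by
  obtain ⟨D, _, _, _, _, rfl, h⟩ := exists_divisionRing x
  rw [hx, one_pow] at h
  rw [← brauerClass_self]
  have hb : (⊥ : Subalgebra K D) = ⊤ := Subalgebra.bot_eq_top_iff_finrank_eq_one.2 h
  exact brauerClass_congr ((Subalgebra.topEquiv.symm.trans
    (Subalgebra.equivOfEq _ _ hb.symm)).trans (Algebra.botEquiv K D))

section Degree

variable (A : Type u) [Ring A] [Algebra K A] [Algebra.IsCentral K A] [IsSimpleRing A]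
  [FiniteDimensional K A] {n : ℕ}

theorem exists_algEquiv_matrix_of_degree (hn : Module.finrank K A = n ^ 2) :
    ∃ (r : ℕ) (_ : NeZero r) (D : Type u)
      (_ : DivisionRing D) (_ : Algebra K D) (_ : FiniteDimensional K D)
      (_ : Algebra.IsCentral K D),
    brauerClass K A = brauerClass K D ∧ n = r * index (brauerClass K A) ∧
    Nonempty (A ≃ₐ[K] Matrix (Fin r) (Fin r) D) := by
  obtain ⟨r, hr, D, _, _, _, _, ⟨e⟩⟩ := exists_algEquiv_matrix K A
  have h := brauerClass_eq_of_matrix e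
  refine ⟨r, hr, D, _, _, ‹_›, ‹_›, h, ?_, ⟨e⟩⟩
  have hfin := e.toLinearEquiv.finrank_eq
  rw [hn, Module.finrank_matrix, finrank_eq_index_sq, ← h] at hfin
  simp only [Fintype.card_fin] at hfin
  exact Nat.pow_left_injective two_ne_zero (by simp only [hfin]; ring)

theorem index_dvd_degree (hn : Module.finrank K A = n ^ 2) : index (brauerClass K A) ∣ n := by
  obtain ⟨r, -, -, -, -, -, -, -, h, -⟩ := exists_algEquiv_matrix_of_degree A hn
  exact ⟨r, h.trans (mul_comm _ _)⟩

theorem degree_mul_index_dvd_finrank (hn : Module.finrank K A = n ^ 2) (M : Type*)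
    [AddCommGroup M] [Module K M] [Module A M] [IsScalarTower K A M] [FiniteDimensional K M] :
    n * index (brauerClass K A) ∣ Module.finrank K M := by
  obtain ⟨r, _, D, _, _, _, _, h, hr, ⟨e⟩⟩ := exists_algEquiv_matrix_of_degree A hn
  have := IsArtinianRing.of_finite K A
  have := mul_finrank_dvd_finrank e M
  rwa [finrank_eq_index_sq, ← h, sq, ← mul_assoc, ← hr] at this

end Degree

theorem index_mul_dvd (x y : BrauerGroup.{u, u} K) : index (x * y) ∣ index x * index y := by
  obtain ⟨D, _, _, _, _, rfl, hD⟩ := exists_divisionRing x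
  obtain ⟨E, _, _, _, _, rfl, hE⟩ := exists_divisionRing y
  rw [brauerClass_mul]
  apply index_dvd_degree
  rw [Module.finrank_tensorProduct, hD, hE, mul_pow]

theorem not_dvd_index_pow {p : ℕ} (hp : p.Prime) {x : BrauerGroup.{u, u} K} (h : ¬ p ∣ index x)
    (k : ℕ) : ¬ p ∣ index (x ^ k) := by
  induction k with
  | zero => simpa [index_one] using hp.one_lt.ne'
  | succ k ih =>
    rw [pow_succ]
    exact fun hd ↦ (hp.dvd_mul.1 (hd.trans (index_mul_dvd _ _))).elim ih h

end Index

section ReducedTrace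

theorem trace_mulRight_matrix {F ν : Type*} [Field F] [Fintype ν] [DecidableEq ν]
    (X : Matrix ν ν F) :
    LinearMap.trace F (Matrix ν ν F) (LinearMap.mulRight F X) = Fintype.card ν * X.trace := by
  rw [LinearMap.trace_eq_matrix_trace F (Matrix.stdBasis F ν ν), Matrix.trace]
  simp only [Matrix.diag_apply, LinearMap.toMatrix_apply, LinearMap.mulRight_apply,
    Fintype.sum_prod_type, Matrix.stdBasis_eq_single]
  have (i j : ν) : (Matrix.stdBasis F ν ν).repr (Matrix.single i j 1 * X) (i, j) = X j j := by
    simp [Matrix.stdBasis, Pi.basis_repr]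
  simp [this, Matrix.trace]

variable {K A F ν : Type*} [Field K] [Ring A] [Algebra K A] [Field F] [Algebra K F] [Fintype ν]
  [DecidableEq ν] (Φ : A →ₐ[K] Matrix ν ν F)

/-- The extension of scalars of a matrix representation. -/
noncomputable def baseChangeRep : F ⊗[K] A →ₐ[F] Matrix ν ν F :=
  Algebra.TensorProduct.lift (Algebra.ofId F _) Φ fun x _ ↦ by
    rw [Algebra.ofId_apply]
    exact Algebra.commute_algebraMap_left x _

theorem baseChangeRep_tmul (c : F) (a : A) : baseChangeRep Φ (c ⊗ₜ a) = c • Φ a := by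
  rw [baseChangeRep, Algebra.TensorProduct.lift_tmul, Algebra.ofId_apply, Algebra.smul_def]

variable [Algebra.IsCentral K A] [IsSimpleRing A] [FiniteDimensional K A] {Φ}

theorem baseChangeRep_bijective (h : Module.finrank K A = Fintype.card ν ^ 2) :
    Function.Bijective (baseChangeRep Φ) := by
  have hν : Nonempty ν := by
    by_contra hν
    rw [not_nonempty_iff] at hν
    simp [Module.finrank_pos.ne'] at h
  have hinj : Function.Injective (baseChangeRep Φ) := (baseChangeRep Φ).toRingHom.injective
  refine ⟨hinj, ?_⟩
  refine (LinearMap.injective_iff_surjective_of_finrank_eq_finrank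
    (f := (baseChangeRep Φ).toLinearMap) ?_).1 hinj
  rw [Module.finrank_baseChange, h, Module.finrank_matrix]
  simp [sq]

theorem algebraMap_trace_mulRight (h : Module.finrank K A = Fintype.card ν ^ 2) (a : A) :
    algebraMap K F (LinearMap.trace K A (LinearMap.mulRight K a)) =
      Fintype.card ν * (Φ a).trace := by
  let e := (AlgEquiv.ofBijective _ (baseChangeRep_bijective (Φ := Φ) h)).toLinearEquiv
  rw [← LinearMap.trace_baseChange, ← LinearMap.trace_conj' _ e, ← trace_mulRight_matrix]
  congr 1
  refine LinearMap.ext fun X ↦ ?_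
  obtain ⟨t, rfl⟩ := e.surjective X
  rw [LinearEquiv.conj_apply_apply, LinearEquiv.symm_apply_apply, LinearMap.mulRight_apply]
  change baseChangeRep Φ _ = baseChangeRep Φ t * Φ a
  induction t with
  | zero => simp
  | add s t hs ht => rw [map_add, map_add, hs, ht, map_add, add_mul]
  | tmul c x => simp [baseChangeRep_tmul]

theorem exists_swap_element [CharZero K] (h : Module.finrank K A = Fintype.card ν ^ 2) :
    ∃ (m : ℕ) (x y : Fin m → A), ∀ a b c d, ∑ i, Φ (x i) a b * Φ (y i) c d =
      if a = d ∧ b = c then 1 else 0 := by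
  have hν : (Fintype.card ν : K) ≠ 0 := by
    rw [Nat.cast_ne_zero]
    rintro h0
    simp [h0, Module.finrank_pos.ne'] at h
  let T : Module.End K A := (Algebra.linearMap K A) ∘ₗ
    ((Fintype.card ν : K)⁻¹ • (LinearMap.trace K A ∘ₗ (LinearMap.mul K A).flip))
  obtain ⟨t, ht⟩ := mulLeftRight_surjective A T
  obtain ⟨s, rfl⟩ := TensorProduct.exists_finset t
  have key (Y : Matrix ν ν F) :
      ∑ i ∈ s, Φ i.1 * Y * Φ i.2.unop = Y.trace • (1 : Matrix ν ν F) := by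
    obtain ⟨t, rfl⟩ := (baseChangeRep_bijective (Φ := Φ) h).2 Y
    induction t with
    | zero => simp
    | add u v hu hv =>
      simp only [map_add, mul_add, add_mul, Finset.sum_add_distrib, hu, hv, Matrix.trace_add,
        add_smul]
    | tmul c a =>
      have hT : Φ (T a) = (Φ a).trace • (1 : Matrix ν ν F) := by
        have : T a = algebraMap K A ((Fintype.card ν : K)⁻¹ *
          LinearMap.trace K A (LinearMap.mulRight K a)) := rfl
        rw [this, AlgHom.commutes, IsScalarTower.algebraMap_apply K F, map_mul,
          algebraMap_trace_mulRight (Φ := Φ) h, ← mul_assoc, map_inv₀, map_natCast,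
          inv_mul_cancel₀, one_mul, Algebra.algebraMap_eq_smul_one]
        simpa using (algebraMap K F).injective.ne hν
      rw [baseChangeRep_tmul, Matrix.trace_smul, smul_assoc, ← hT, ← ht]
      simp [AlgHom.mulLeftRight_apply, Finset.smul_sum]
  refine ⟨s.card, fun i ↦ (s.equivFin.symm i).1.1, fun i ↦ (s.equivFin.symm i).1.2.unop,
    fun a b c d ↦ ?_⟩
  have h1 := congr_fun₂ (key (Matrix.single b c 1)) a d
  rw [Matrix.sum_apply, ← s.sum_coe_sort, ← s.equivFin.symm.sum_comp] at h1
  simp only [Matrix.mul_apply, Matrix.single_apply, ite_and, mul_ite, mul_one, mul_zero,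
    Finset.sum_ite_eq, Finset.mem_univ, if_true, ite_mul, zero_mul] at h1
  rw [h1, Matrix.smul_apply, Matrix.one_apply]
  rcases eq_or_ne b c with rfl | hbc
  · simp
  · simp [hbc, Matrix.trace_single_eq_of_ne]

end ReducedTrace

section TensorPower

universe u

variable {K A F ν : Type*} [Field K] [Ring A] [Algebra K A] [Field F] [Algebra K F] [Fintype ν]
  [DecidableEq ν] (Φ : A →ₐ[K] Matrix ν ν F)

/-- The Kronecker product of `k` matrices. -/
def piKronecker {k : ℕ} (M : Fin k → Matrix ν ν F) : Matrix (Fin k → ν) (Fin k → ν) F :=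
  .of fun f h ↦ ∏ i, M i (f i) (h i)

/-- The tensor product of two matrix representations. -/
noncomputable def tensorRep {C μ : Type*} [Ring C] [Algebra K C] [Fintype μ] [DecidableEq μ]
    (Ψ : C →ₐ[K] Matrix μ μ F) : A ⊗[K] C →ₐ[K] Matrix (ν × μ) (ν × μ) F :=
  ((Algebra.TensorProduct.lmul' K).mapMatrix.comp
    (Matrix.kroneckerTMulAlgEquiv ν μ K K F F).toAlgHom).comp (Algebra.TensorProduct.map Φ Ψ)

theorem tensorRep_tmul {C μ : Type*} [Ring C] [Algebra K C] [Fintype μ] [DecidableEq μ]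
    (Ψ : C →ₐ[K] Matrix μ μ F) (a : A) (c : C) (i j : ν × μ) :
    tensorRep Φ Ψ (a ⊗ₜ c) i j = Φ a i.1 j.1 * Ψ c i.2 j.2 := by
  simp [tensorRep]

theorem exists_tensorPower {K A : Type u} [Field K] [Ring A] [Algebra K A] [Algebra.IsCentral K A]
    [IsSimpleRing A] [FiniteDimensional K A] [Algebra K F] (Φ : A →ₐ[K] Matrix ν ν F)
    (h : Module.finrank K A = Fintype.card ν ^ 2) (k : ℕ) :
    ∃ (C : Type u) (_ : Ring C) (_ : Algebra K C) (_ : Algebra.IsCentral K C) (_ : IsSimpleRing C)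
      (_ : FiniteDimensional K C) (Ψ : C →ₐ[K] Matrix (Fin k → ν) (Fin k → ν) F),
      brauerClass K C = brauerClass K A ^ k ∧
      Module.finrank K C = Fintype.card (Fin k → ν) ^ 2 ∧
      ∀ a : Fin k → A, piKronecker (fun i ↦ Φ (a i)) ∈ Ψ.range := by
  induction k with
  | zero =>
    refine ⟨K, _, _, inferInstance, inferInstance, inferInstance, Algebra.ofId K _, ?_, ?_,
      fun a ↦ ⟨1, ?_⟩⟩
    · rw [brauerClass_self, pow_zero]
    · simp
    · ext f g
      simp [piKronecker, Subsingleton.elim f g]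
  | succ k ih =>
    obtain ⟨C, _, _, _, _, _, Ψ, hC, hfin, hΨ⟩ := ih
    refine ⟨A ⊗[K] C, _, _, inferInstance, inferInstance, inferInstance,
      (Matrix.reindexAlgEquiv K F (Fin.consEquiv fun _ ↦ ν)).toAlgHom.comp (tensorRep Φ Ψ),
      ?_, ?_, fun a ↦ ?_⟩
    · rw [← brauerClass_mul, hC, pow_succ']
    · rw [Module.finrank_tensorProduct, h, hfin]
      simp only [Fintype.card_pi, Fintype.card_fin, Finset.prod_const, Finset.card_univ]
      ring
    · obtain ⟨c, hc⟩ := hΨ fun i ↦ a i.succ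
      refine ⟨a 0 ⊗ₜ c, ?_⟩
      ext f g
      have hc' := congr_fun₂ hc (Fin.tail f) (Fin.tail g)
      simp only [piKronecker, Matrix.of_apply, Fin.tail] at hc'
      simp [piKronecker, tensorRep_tmul, Fin.prod_univ_succ, Fin.consEquiv]
      exact Or.inl hc'

/-- The action of a permutation of the tensor factors, as a matrix. -/
def factorPerm (F ν : Type*) [Field F] [DecidableEq ν] {k : ℕ} (σ : Equiv.Perm (Fin k)) :
    Matrix (Fin k → ν) (Fin k → ν) F :=
  .of fun f h ↦ if h = f ∘ σ then 1 else 0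

theorem factorPerm_one (F ν : Type*) [Field F] [DecidableEq ν] {k : ℕ} :
    factorPerm F ν (1 : Equiv.Perm (Fin k)) = 1 := by
  ext f h
  simp [factorPerm, Matrix.one_apply, eq_comm]

theorem factorPerm_mul {k : ℕ} (σ τ : Equiv.Perm (Fin k)) :
    factorPerm F ν (σ * τ) = factorPerm F ν σ * factorPerm F ν τ := by
  ext f h
  simp only [factorPerm, Matrix.mul_apply, Matrix.of_apply, ite_mul, one_mul, zero_mul,
    Finset.sum_ite_eq', Finset.mem_univ, if_true]
  rfl

theorem sum_piKronecker_swap {F ν : Type*} [Field F] [DecidableEq ν] {k m : ℕ}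
    {X Y : Fin m → Matrix ν ν F}
    (h : ∀ a b c d, ∑ l, X l a b * Y l c d = if a = d ∧ b = c then 1 else 0) {i j : Fin k}
    (hij : i ≠ j) :
    ∑ l, piKronecker (Function.update (Function.update 1 i (X l)) j (Y l)) =
      factorPerm F ν (Equiv.swap i j) := by
  ext f g
  rw [Matrix.sum_apply]
  have hprod (l : Fin m) : piKronecker (Function.update (Function.update 1 i (X l)) j (Y l)) f g =
      X l (f i) (g i) * Y l (f j) (g j) *
        ∏ x ∈ (Finset.univ.erase i).erase j, (1 : Matrix ν ν F) (f x) (g x) := by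
    rw [piKronecker, Matrix.of_apply, ← Finset.mul_prod_erase _ _ (Finset.mem_univ i),
      ← Finset.mul_prod_erase _ _ (Finset.mem_erase.2 ⟨hij.symm, Finset.mem_univ j⟩), mul_assoc]
    congr 1
    · simp [hij]
    congr 1
    · simp
    refine Finset.prod_congr rfl fun x hx ↦ ?_
    simp only [Finset.mem_erase] at hx
    simp [hx]
  simp only [hprod, ← Finset.sum_mul, h, factorPerm, Matrix.of_apply, Matrix.one_apply]
  rw [Finset.prod_ite_zero]
  simp only [Finset.prod_const_one, ite_zero_mul_ite_zero, mul_one]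
  refine if_congr ?_ rfl rfl
  rw [funext_iff]
  constructor
  · rintro ⟨⟨h1, h2⟩, h3⟩ x
    rcases eq_or_ne x i with rfl | hi
    · simp [h2]
    rcases eq_or_ne x j with rfl | hj
    · simp [h1]
    simp [Equiv.swap_apply_of_ne_of_ne hi hj, h3 x (by simp [hi, hj])]
  · refine fun hx ↦ ⟨⟨by simp [hx j], by simp [hx i]⟩, fun x h ↦ ?_⟩
    simp only [Finset.mem_erase] at h
    simp [hx x, Equiv.swap_apply_of_ne_of_ne h.2.1 h.1]

theorem factorPerm_mem_range [CharZero K] [Algebra.IsCentral K A] [IsSimpleRing A]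
    [FiniteDimensional K A] (h : Module.finrank K A = Fintype.card ν ^ 2) {k : ℕ}
    {C : Type*} [Ring C] [Algebra K C] (Ψ : C →ₐ[K] Matrix (Fin k → ν) (Fin k → ν) F)
    (hΨ : ∀ a : Fin k → A, piKronecker (fun i ↦ Φ (a i)) ∈ Ψ.range) (σ : Equiv.Perm (Fin k)) :
    factorPerm F ν σ ∈ Ψ.range := by
  induction σ using Equiv.Perm.swap_induction_on with
  | one => exact factorPerm_one F ν ▸ Ψ.range.one_mem
  | swap_mul σ i j hij ih =>
    rw [factorPerm_mul]
    refine Ψ.range.mul_mem ?_ ih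
    obtain ⟨m, x, y, hxy⟩ := exists_swap_element (Φ := Φ) h
    rw [← sum_piKronecker_swap hxy hij]
    refine Ψ.range.sum_mem fun l _ ↦ ?_
    convert hΨ (Function.update (Function.update 1 i (x l)) j (y l)) using 2
    ext1 t
    rcases eq_or_ne t j with rfl | hj
    · simp
    rcases eq_or_ne t i with rfl | hi
    · simp [hj]
    · simp [hi, hj]

end TensorPower

section CyclicIdempotent

universe u

/-- The sum of the matrices of all cyclic shifts of the tensor factors. -/
def cyclicSum (F ν : Type*) [Field F] [DecidableEq ν] (p : ℕ) [NeZero p] :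
    Matrix (Fin p → ν) (Fin p → ν) F :=
  ∑ i : Fin p, factorPerm F ν (Equiv.addRight i)

variable (F ν : Type*) [Field F] [Fintype ν] [DecidableEq ν] (p : ℕ) [NeZero p]

theorem cyclicSum_mul_self : cyclicSum F ν p * cyclicSum F ν p = (p : F) • cyclicSum F ν p := by
  have h (i : Fin p) : factorPerm F ν (Equiv.addRight i) * cyclicSum F ν p = cyclicSum F ν p := by
    have hmul (j : Fin p) : (Equiv.addRight i * Equiv.addRight j : Equiv.Perm (Fin p)) =
        Equiv.addRight (Equiv.addRight i j) := by
      ext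
      simp [add_assoc]
    simp only [cyclicSum, Finset.mul_sum, ← factorPerm_mul, hmul]
    exact Equiv.sum_comp (Equiv.addRight i) fun j ↦ factorPerm F ν (Equiv.addRight j)
  conv_lhs => enter [1]; rw [cyclicSum]
  simp [Finset.sum_mul, h, Nat.cast_smul_eq_nsmul]

theorem trace_factorPerm {k : ℕ} (σ : Equiv.Perm (Fin k)) :
    (factorPerm F ν σ).trace = Fintype.card {f : Fin k → ν // f = f ∘ σ} := by
  simp [Matrix.trace, factorPerm, Fintype.card_subtype]

theorem trace_cyclicSum (hp : p.Prime) :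
    (cyclicSum F ν p).trace = (Fintype.card ν ^ p + (p - 1) * Fintype.card ν : ℕ) := by
  have h0 : (factorPerm F ν (Equiv.addRight (0 : Fin p))).trace = (Fintype.card ν ^ p : ℕ) := by
    rw [trace_factorPerm, Fintype.card_subtype]
    simp
  have hne (i : Fin p) (hi : i ≠ 0) :
      (factorPerm F ν (Equiv.addRight i)).trace = (Fintype.card ν : ℕ) := by
    rw [trace_factorPerm]
    congr 1
    refine (Fintype.card_congr (Equiv.ofBijective
      (fun a : ν ↦ (⟨fun _ ↦ a, rfl⟩ : {f : Fin p → ν // f = f ∘ Equiv.addRight i}))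
      ⟨fun a b hab ↦ congr_fun (congr_arg Subtype.val hab) 0, ?_⟩)).symm
    rintro ⟨f, hf⟩
    refine ⟨f 0, Subtype.ext (funext fun x ↦ ?_)⟩
    have hk (k : ℕ) : f (k • i) = f 0 := by
      induction k with
      | zero => simp
      | succ k ih =>
        rw [succ_nsmul, ← ih]
        exact (congr_fun hf (k • i)).symm
    have : Fact p.Prime := ⟨hp⟩
    obtain ⟨k, rfl⟩ := (mem_multiples_of_prime_card (G := Fin p) (p := p) (by simp) hi : x ∈ _)
    exact (hk k).symm
  rw [cyclicSum, Matrix.trace_sum, ← Finset.add_sum_erase _ _ (Finset.mem_univ 0), h0,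
    Finset.sum_congr rfl fun i hi ↦ hne i (Finset.ne_of_mem_erase hi)]
  simp [Finset.card_erase_of_mem]

theorem trace_mulRight_of_isIdempotentElem {K C : Type*} [Field K] [Ring C] [Algebra K C]
    [FiniteDimensional K C] {u : C} (hu : IsIdempotentElem u) :
    LinearMap.trace K C (LinearMap.mulRight K u) =
      Module.finrank K (LinearMap.range (LinearMap.toSpanSingleton C C u)) := by
  have h : LinearMap.IsProj
      ((LinearMap.range (LinearMap.toSpanSingleton C C u)).restrictScalars K)
      (LinearMap.mulRight K u) := by
    refine ⟨fun x ↦ ⟨x, rfl⟩, ?_⟩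
    rintro _ ⟨x, rfl⟩
    simp [mul_assoc, hu.eq]
  exact h.trace

theorem prime_mul_index_pow_dvd {K : Type u} [Field K] [CharZero K] (x : BrauerGroup.{u, u} K)
    {p : ℕ} (hp : p.Prime) :
    p * index (x ^ p) ∣ index x ^ p + (p - 1) * index x := by
  have : NeZero p := ⟨hp.ne_zero⟩
  obtain ⟨D, _, _, _, _, rfl, hD⟩ := exists_divisionRing x
  set d := index (brauerClass K D)
  let F := AlgebraicClosure K
  obtain ⟨n, hn, ⟨e⟩, hfin⟩ := exists_baseChange_algEquiv K D F
  obtain rfl : n = d := Nat.pow_left_injective two_ne_zero (hfin.symm.trans hD)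
  let Φ : D →ₐ[K] Matrix (Fin d) (Fin d) F :=
    (e.toAlgHom.restrictScalars K).comp Algebra.TensorProduct.includeRight
  have hΦ : Module.finrank K D = Fintype.card (Fin d) ^ 2 := by simpa using hD
  obtain ⟨C, _, _, _, _, _, Ψ, hC, hCfin, hΨ⟩ := exists_tensorPower Φ hΦ p
  obtain ⟨s, hs : Ψ s = cyclicSum F (Fin d) p⟩ : cyclicSum F (Fin d) p ∈ Ψ.range :=
    Ψ.range.sum_mem fun i _ ↦ factorPerm_mem_range Φ hΦ Ψ hΨ _
  have hΨinj : Function.Injective Ψ := Ψ.toRingHom.injective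
  have hpK : (p : K) ≠ 0 := Nat.cast_ne_zero.2 hp.ne_zero
  have : CharZero F := charZero_of_injective_algebraMap (algebraMap K F).injective
  have hpF : (p : F) ≠ 0 := Nat.cast_ne_zero.2 hp.ne_zero
  have hss : s * s = (p : K) • s := hΨinj <| by
    rw [map_mul, map_smul, hs, cyclicSum_mul_self, Nat.cast_smul_eq_nsmul,
      Nat.cast_smul_eq_nsmul]
  have hu : IsIdempotentElem ((p : K)⁻¹ • s) := by
    rw [IsIdempotentElem, smul_mul_smul_comm, hss, smul_smul]
    congr 1
    field_simp
  have htr := algebraMap_trace_mulRight (Φ := Ψ) hCfin ((p : K)⁻¹ • s)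
  rw [trace_mulRight_of_isIdempotentElem hu, map_natCast, map_smul, hs, Matrix.trace_smul,
    trace_cyclicSum F (Fin d) p hp, Algebra.smul_def (p : K)⁻¹ (Nat.cast _ : F), map_inv₀,
    map_natCast] at htr
  have hdvd := degree_mul_index_dvd_finrank C hCfin
    (LinearMap.range (LinearMap.toSpanSingleton C C ((p : K)⁻¹ • s)))
  set L := Module.finrank K (LinearMap.range (LinearMap.toSpanSingleton C C ((p : K)⁻¹ • s)))
  have hL : p * L = Fintype.card (Fin p → Fin d) * (d ^ p + (p - 1) * d) := by
    have : (p : F) * L = Fintype.card (Fin p → Fin d) *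
        (Fintype.card (Fin d) ^ p + (p - 1) * Fintype.card (Fin d) : ℕ) := by
      rw [htr, mul_left_comm, mul_inv_cancel_left₀ hpF]
    rw [Fintype.card_fin d] at this
    exact Nat.cast_injective (R := F) (by rw [Nat.cast_mul, Nat.cast_mul, this])
  have hN : 0 < Fintype.card (Fin p → Fin d) := Fintype.card_pos
  rw [hC] at hdvd
  refine Nat.dvd_of_mul_dvd_mul_left hN ?_
  rw [← hL, mul_left_comm]
  exact mul_dvd_mul_left p hdvd

end CyclicIdempotent

section Decomposition

universe u

variable {K : Type u} [Field K]

theorem exists_not_dvd_index_pow [CharZero K] {p : ℕ} (hp : p.Prime) (x : BrauerGroup.{u, u} K) :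
    ∃ e, ¬ p ∣ index (x ^ p ^ e) := by
  suffices H : ∀ v (x : BrauerGroup.{u, u} K), ¬ p ^ (v + 1) ∣ index x →
      ∃ e, ¬ p ∣ index (x ^ p ^ e) from
    H (index x) x fun h ↦ absurd (Nat.le_of_dvd (index_pos x) h)
      ((Nat.lt_pow_self hp.one_lt).trans (Nat.pow_lt_pow_succ hp.one_lt)).not_ge
  intro v
  induction v with
  | zero => exact fun x hx ↦ ⟨0, by simpa using hx⟩
  | succ v ih =>
    intro x hx
    by_cases hpx : p ∣ index x
    · suffices h : ¬ p ^ (v + 1) ∣ index (x ^ p) by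
        obtain ⟨e, he⟩ := ih (x ^ p) h
        exact ⟨e + 1, by rwa [pow_succ', pow_mul]⟩
      refine fun h ↦ hx ?_
      obtain ⟨k, rfl⟩ : ∃ k, p = k + 2 := ⟨p - 2, by have := hp.two_le; omega⟩
      have hdvd := (mul_dvd_mul_left (k + 2) h).trans (prime_mul_index_pow_dvd x hp)
      rw [← pow_succ', pow_succ (index x), ← add_mul] at hdvd
      refine Nat.Coprime.dvd_of_dvd_mul_left (Nat.Coprime.pow_left _ ?_) hdvd
      rw [hp.coprime_iff_not_dvd, Nat.dvd_add_right (dvd_pow hpx (by simp))]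
      exact Nat.not_dvd_of_pos_of_lt (by simp) (by simp)
    · exact ⟨0, by simpa using hpx⟩

theorem exists_odd_pow_index [CharZero K] (x : BrauerGroup.{u, u} K) :
    ∃ n, Odd n ∧ ∀ q : ℕ, q.Prime → q ∣ index (x ^ n) → q = 2 := by
  suffices H : ∀ s : Finset ℕ, ∃ n, Odd n ∧ ∀ q ∈ s, q.Prime → q ∣ index (x ^ n) → q = 2 by
    obtain ⟨n, hn, h⟩ := H (index x).primeFactors
    refine ⟨n, hn, fun q hq hd ↦ ?_⟩
    by_cases hqx : q ∣ index x
    · exact h q (Nat.mem_primeFactors.2 ⟨hq, hqx, (index_pos x).ne'⟩) hq hd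
    · exact absurd hd (not_dvd_index_pow hq hqx n)
  intro s
  induction s using Finset.induction_on with
  | empty => exact ⟨1, odd_one, by simp⟩
  | insert a s ha ih =>
    obtain ⟨n, hn, h⟩ := ih
    have hpow (k q : ℕ) (hq : q.Prime) (hqs : q ∈ s) (hd : q ∣ index (x ^ (n * k))) : q = 2 := by
      rw [pow_mul] at hd
      exact h q hqs hq (not_imp_not.1 (not_dvd_index_pow hq · k) hd)
    by_cases ha2 : a.Prime ∧ a ≠ 2
    · obtain ⟨e, he⟩ := exists_not_dvd_index_pow ha2.1 (x ^ n)
      refine ⟨n * a ^ e, hn.mul (ha2.1.odd_of_ne_two ha2.2).pow, fun q hqs hq hd ↦ ?_⟩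
      obtain rfl | hqs := Finset.mem_insert.1 hqs
      · exact absurd (by rwa [pow_mul] at hd) he
      · exact hpow _ q hq hqs hd
    · refine ⟨n, hn, fun q hqs hq hd ↦ ?_⟩
      obtain rfl | hqs := Finset.mem_insert.1 hqs
      · exact not_not.1 fun h2 ↦ ha2 ⟨hq, h2⟩
      · exact h q hqs hq hd

theorem exists_two_primary_decomposition [CharZero K] (x : BrauerGroup.{u, u} K) :
    ∃ y z, x = y * z ∧ (∀ q : ℕ, q.Prime → q ∣ index y → q = 2) ∧ Odd (index z) := by
  obtain ⟨n, hn, hodd⟩ := exists_odd_pow_index x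
  obtain ⟨e, he⟩ := exists_not_dvd_index_pow Nat.prime_two x
  have hco : n.Coprime (2 ^ e) := hn.coprime_two_right.pow_right e
  have hx : x ^ (n * 2 ^ e) = 1 := by
    refine eq_one_of_index_eq_one (Nat.eq_one_iff_not_exists_prime_dvd.2 fun q hq hd ↦ ?_)
    obtain rfl : q = 2 := hodd q hq <| not_imp_not.1 (not_dvd_index_pow hq · (2 ^ e)) <| by
      rwa [← pow_mul]
    rw [mul_comm, pow_mul] at hd
    exact not_dvd_index_pow hq he n hd
  obtain ⟨s, hs0, hs1⟩ := Nat.chineseRemainder hco 0 1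
  obtain ⟨t, ht1, ht0⟩ := Nat.chineseRemainder hco 1 0
  obtain ⟨a, rfl⟩ := (Nat.modEq_zero_iff_dvd.1 hs0)
  obtain ⟨b, rfl⟩ := (Nat.modEq_zero_iff_dvd.1 ht0)
  refine ⟨x ^ (n * a), x ^ (2 ^ e * b), ?_, fun q hq hd ↦ ?_, ?_⟩
  · rw [← pow_add, eq_comm]
    nth_rw 2 [← pow_one x]
    exact pow_eq_pow_of_modEq ((Nat.modEq_and_modEq_iff_modEq_mul hco).1
      ⟨hs0.add ht1, hs1.add ht0⟩) hx
  · rw [pow_mul] at hd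
    exact hodd q hq (not_imp_not.1 (not_dvd_index_pow hq · a) hd)
  · rw [pow_mul, ← Nat.not_even_iff_odd, even_iff_two_dvd]
    exact not_dvd_index_pow Nat.prime_two he b

theorem index_dvd_index_mul_mul (x y : BrauerGroup.{u, u} K) :
    index x ∣ index (x * y) * index y := by
  obtain ⟨D, _, _, _, _, rfl, hD⟩ := exists_divisionRing x
  obtain ⟨E, _, _, _, _, rfl, hE⟩ := exists_divisionRing y
  have hDE : Module.finrank K (D ⊗[K] E) =
      (index (brauerClass K D) * index (brauerClass K E)) ^ 2 := by
    rw [Module.finrank_tensorProduct, hD, hE, mul_pow]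
  obtain ⟨r, _, B, _, _, _, _, h, hr, ⟨e⟩⟩ := exists_algEquiv_matrix_of_degree (D ⊗[K] E) hDE
  let φ : D →ₐ[K] Matrix (Fin r) (Fin r) B :=
    e.toAlgHom.comp Algebra.TensorProduct.includeLeft
  let := Module.compHom (Fin r → B) φ.toRingHom
  have hφ (d : D) (v : Fin r → B) : φ d • v = d • v := rfl
  have : IsScalarTower K D (Fin r → B) := ⟨fun k d v ↦ by simp [← hφ]⟩
  have hdvd := degree_mul_index_dvd_finrank D hD (Fin r → B)
  rw [Module.finrank_pi_fintype, Finset.sum_const, Finset.card_univ, Fintype.card_fin,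
    finrank_eq_index_sq, ← h, smul_eq_mul, sq, ← mul_assoc, ← hr, mul_assoc] at hdvd
  rw [mul_comm, brauerClass_mul]
  exact Nat.dvd_of_mul_dvd_mul_left (index_pos _) hdvd

theorem nonempty_algEquiv_tensorProduct (B D E : Type u) [DivisionRing B] [Algebra K B]
    [FiniteDimensional K B] [Algebra.IsCentral K B] [DivisionRing D] [Algebra K D]
    [FiniteDimensional K D] [Algebra.IsCentral K D] [DivisionRing E] [Algebra K E]
    [FiniteDimensional K E] [Algebra.IsCentral K E]
    (h : brauerClass K B = brauerClass K D * brauerClass K E)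
    (hfin : Module.finrank K B = Module.finrank K D * Module.finrank K E) :
    Nonempty (B ≃ₐ[K] D ⊗[K] E) := by
  have hDE : Module.finrank K (D ⊗[K] E) = index (brauerClass K B) ^ 2 := by
    rw [Module.finrank_tensorProduct, ← hfin, finrank_eq_index_sq]
  obtain ⟨r, _, B', _, _, _, _, h', hr, ⟨e⟩⟩ := exists_algEquiv_matrix_of_degree (D ⊗[K] E) hDE
  rw [← brauerClass_mul, ← h] at h' hr
  obtain ⟨f⟩ := nonempty_algEquiv_of_brauerClass_eq h'
  obtain rfl : r = 1 := (Nat.mul_eq_right (index_pos _).ne').1 hr.symm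
  let g := Matrix.scalarAlgHom (α := B') (Fin 1) K
  have hg : Function.Bijective g := ⟨g.toRingHom.injective, fun M ↦
    ⟨M 0 0, by ext i j; simp [g, Subsingleton.elim i 0, Subsingleton.elim j 0]⟩⟩
  exact ⟨(f.trans (.ofBijective g hg)).trans e.symm⟩

end Decomposition

end CentralSimple

open CentralSimple in
/-- Let `K` be a number field and let `B` be a central division algebra over
`K` of dimension `(2m)²` with `m` odd.  Then `B ≅ B₁ ⊗[K] B₂` for some central division
`K`-algebra `B₁` of dimension `4` (a quaternion algebra) and some central division `K`-algebra
`B₂` of dimension `m²`. -/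
theorem selectivity_stmt4
    (K : Type) [Field K] [NumberField K]
    (B : Type) [DivisionRing B] [Algebra K B]
    [Algebra.IsCentral K B] [FiniteDimensional K B]
    (m : ℕ) (hm : Odd m) (hm0 : 0 < m)
    (hdim : Module.finrank K B = (2 * m) ^ 2) :
    ∃ (B₁ : Type) (_ : DivisionRing B₁) (_ : Algebra K B₁)
      (B₂ : Type) (_ : DivisionRing B₂) (_ : Algebra K B₂),
      Algebra.IsCentral K B₁ ∧ Module.finrank K B₁ = 4 ∧
      Algebra.IsCentral K B₂ ∧ Module.finrank K B₂ = m ^ 2 ∧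
      Nonempty (B ≃ₐ[K] B₁ ⊗[K] B₂) := by
  have hB : index (brauerClass K B) = 2 * m :=
    Nat.pow_left_injective two_ne_zero ((finrank_eq_index_sq B).symm.trans hdim)
  obtain ⟨y, z, hyz, hy, hz⟩ := exists_two_primary_decomposition (brauerClass K B)
  have h1 : index y ∣ 2 := by
    have h := index_dvd_index_mul_mul y z
    rw [← hyz, hB, mul_assoc] at h
    refine Nat.Coprime.dvd_of_dvd_mul_right (Nat.Coprime.symm ?_) h
    exact Nat.coprime_of_dvd fun q hq hq1 hq2 ↦ by
      obtain rfl := hy q hq hq2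
      exact Nat.not_even_iff_odd.2 (hm.mul hz) (even_iff_two_dvd.2 hq1)
  have h2 : index z ∣ m := by
    have h := index_dvd_index_mul_mul z y
    rw [mul_comm z, ← hyz, hB] at h
    have h4 : index z ∣ m * (2 * 2) := h.trans <| by
      rw [mul_assoc, mul_left_comm]
      exact mul_dvd_mul_left m (mul_dvd_mul_left 2 h1)
    exact (hz.coprime_two_right.mul_right hz.coprime_two_right).dvd_of_dvd_mul_right h4
  obtain ⟨B₁, _, _, _, _, hB₁, hfin₁⟩ := exists_divisionRing y
  obtain ⟨B₂, _, _, _, _, hB₂, hfin₂⟩ := exists_divisionRing z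
  have h3 := index_mul_dvd y z
  rw [← hyz, hB] at h3
  have h4 : index y = 2 ∧ index z = m := by
    have hle := Nat.le_of_dvd (Nat.mul_pos (index_pos y) (index_pos z)) h3
    have hy2 := Nat.le_of_dvd two_pos h1
    have hzm := Nat.le_of_dvd hm0 h2
    exact ⟨by nlinarith, by nlinarith⟩
  rw [h4.1] at hfin₁
  rw [h4.2] at hfin₂
  refine ⟨B₁, _, _, B₂, _, _, ‹_›, hfin₁, ‹_›, hfin₂, ?_⟩
  exact nonempty_algEquiv_tensorProduct B B₁ B₂ (by rw [hB₁, hB₂, hyz])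
    (by rw [hfin₁, hfin₂, hdim, mul_pow])
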